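/- Let x, y ∈ Δ_n (the unit simplex in ℝⁿ) with sup_i |x_i − y_i| ≤ n^{−e} and min_i x_i, min_i y_i ≥ n^{−b}, where e > b + 1 > 1. Let i ∈ S, j ∉ S with S ⊆ [n], and set m = (y_i + y_j)/(x_i + x_j), δ = (1/(x_i+x_j))·Σ_{l ∈ S, l ≠ i}(y_l − x_l). Then |m − 1| ≤ n^{b−e}·(something ≤ 1 when n large) and |δ| ≤ n^{b+1−e}; in particular for sufficiently large n, min(1,(1−δ)/m') − max(0,−δ/m') ≥ 1 − 2n^{b+1−e} where m' = max(m, 1/m). -/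

import Mathlib

/-- Sums of two coordinates, each at least `q`, that differ by at most `p` coordinatewise
have ratio within `p / q` of one. -/
theorem abs_add_div_add_sub_one_le {p q a b c d : ℝ} (hq : 0 < q) (ha : q ≤ a) (hb : q ≤ b)
    (hac : |a - c| ≤ p) (hbd : |b - d| ≤ p) : |(c + d) / (a + b) - 1| ≤ p / q := by
  have hab : 0 < a + b := by linarith
  have hp : 0 ≤ p := (abs_nonneg _).trans hac
  have h : (c + d) / (a + b) - 1 = (c + d - (a + b)) / (a + b) := by field_simp
  have hnum : |c + d - (a + b)| ≤ 2 * p := by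
    rw [abs_le] at *
    constructor <;> linarith
  rw [h, abs_div, abs_of_pos hab, div_le_div_iff₀ hab hq]
  calc |c + d - (a + b)| * q ≤ 2 * p * q := by gcongr
    _ = p * (2 * q) := by ring
    _ ≤ p * (a + b) := by gcongr; linarith

/-- A sum of coordinate differences bounded by `p`, divided by `t ≥ q`, is at most
`card ι * (p / q)`. -/
theorem abs_sum_sub_div_le {ι : Type*} [Fintype ι] {p q t : ℝ} {x y : ι → ℝ} (hp : 0 ≤ p)
    (hq : 0 < q) (ht : q ≤ t) (hxy : ∀ i, |x i - y i| ≤ p) (s : Finset ι) :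
    |(∑ l ∈ s, (y l - x l)) / t| ≤ Fintype.card ι * (p / q) := by
  have hsum : |∑ l ∈ s, (y l - x l)| ≤ Fintype.card ι * p := by
    calc |∑ l ∈ s, (y l - x l)| ≤ ∑ l ∈ s, |y l - x l| := Finset.abs_sum_le_sum_abs _ _
      _ ≤ ∑ _l ∈ s, p := Finset.sum_le_sum fun l _ => abs_sub_comm (x l) (y l) ▸ hxy l
      _ = s.card * p := by simp
      _ ≤ Fintype.card ι * p := by gcongr; exact s.card_le_univ
  rw [abs_div, abs_of_pos (hq.trans_le ht), ← mul_div_assoc]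
  gcongr

/-- The reciprocal of `max m m⁻¹` lies in `[1 - a, 1]` as soon as `m` is within `a < 1` of one. -/
theorem inv_max_inv_mem_Icc {m a : ℝ} (ha : a < 1) (hm : |m - 1| ≤ a) :
    (max m m⁻¹)⁻¹ ∈ Set.Icc (1 - a) 1 := by
  obtain ⟨h₁, h₂⟩ := abs_le.mp hm
  have hm₀ : 0 < m := by linarith
  rcases le_total m 1 with h | h
  · rw [max_eq_right (h.trans ((one_le_inv₀ hm₀).mpr h)), inv_inv]
    exact ⟨by linarith, h⟩
  · rw [max_eq_left ((inv_le_one_of_one_le₀ h).trans h)]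
    refine ⟨?_, inv_le_one_of_one_le₀ h⟩
    rw [le_inv_comm₀ (by linarith) hm₀, ← one_div, le_div_iff₀ (by linarith)]
    nlinarith

theorem one_sub_two_mul_le_min_sub_max {v δ a r : ℝ} (har : a ≤ r) (ha : a < 1)
    (hv : v ∈ Set.Icc (1 - a) 1) (hδ : |δ| ≤ r) :
    1 - 2 * r ≤ min 1 ((1 - δ) * v) - max 0 (-δ * v) := by
  obtain ⟨hv₁, hv₂⟩ := hv
  obtain ⟨h₁, h₂⟩ := abs_le.mp hδ
  rcases min_cases 1 ((1 - δ) * v) with ⟨h, -⟩ | ⟨h, -⟩ <;>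
    rcases max_cases 0 (-δ * v) with ⟨h', -⟩ | ⟨h', -⟩ <;> rw [h, h'] <;> nlinarith


theorem subset_coupling_probability
    (b e : ℝ) (hb : 0 < b) (hbe : b + 1 < e) :
    ∃ N : ℕ, ∀ n : ℕ, N ≤ n →
      ∀ x y : Fin n → ℝ,
        (∀ i, 0 ≤ x i) → (∑ i, x i) = 1 →
        (∀ i, 0 ≤ y i) → (∑ i, y i) = 1 →
        (∀ i, |x i - y i| ≤ (n : ℝ) ^ (-e)) →
        (∀ i, (n : ℝ) ^ (-b) ≤ x i) → (∀ i, (n : ℝ) ^ (-b) ≤ y i) →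
        ∀ S : Finset (Fin n), ∀ i ∈ S, ∀ j ∉ S, i ≠ j →
          |((y i + y j) / (x i + x j)) - 1| ≤ (n : ℝ) ^ (b - e) ∧
          |(∑ l ∈ S.erase i, (y l - x l)) / (x i + x j)| ≤ (n : ℝ) ^ (b + 1 - e) ∧
          (letI m := (y i + y j) / (x i + x j)
           letI δ := (∑ l ∈ S.erase i, (y l - x l)) / (x i + x j)
           letI m' := max m m⁻¹
           min 1 ((1 - δ) / m') - max 0 (-δ / m') ≥ 1 - 2 * (n : ℝ) ^ (b + 1 - e)) := by
  refine ⟨2, fun n hn x y _ _ _ _ hxy hx _ S i _ j _ _ => ?_⟩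
  have hn₁ : (1 : ℝ) < n := by exact_mod_cast hn
  have hn₀ : (0 : ℝ) < n := by linarith
  have hq : (0 : ℝ) < (n : ℝ) ^ (-b) := Real.rpow_pos_of_pos hn₀ _
  have hp : (0 : ℝ) ≤ (n : ℝ) ^ (-e) := Real.rpow_nonneg hn₀.le _
  have hdiv : (n : ℝ) ^ (-e) / (n : ℝ) ^ (-b) = (n : ℝ) ^ (b - e) := by
    rw [← Real.rpow_sub hn₀]
    ring_nf
  have hmul : (n : ℝ) * (n : ℝ) ^ (b - e) = (n : ℝ) ^ (b + 1 - e) := by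
    rw [← Real.rpow_one_add' hn₀.le (by linarith)]
    ring_nf
  have hm := abs_add_div_add_sub_one_le hq (hx i) (hx j) (hxy i) (hxy j)
  have hδ := abs_sum_sub_div_le hp hq (by linarith [hx i, hx j] : _ ≤ x i + x j) hxy (S.erase i)
  rw [hdiv] at hm
  rw [hdiv, Fintype.card_fin, hmul] at hδ
  have ha : (n : ℝ) ^ (b - e) < 1 := Real.rpow_lt_one_of_one_lt_of_neg hn₁ (by linarith)
  have har : (n : ℝ) ^ (b - e) ≤ (n : ℝ) ^ (b + 1 - e) :=
    Real.rpow_le_rpow_of_exponent_le hn₁.le (by linarith)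
  refine ⟨hm, hδ, ?_⟩
  simpa only [div_eq_mul_inv, ge_iff_le] using
    one_sub_two_mul_le_min_sub_max har ha (inv_max_inv_mem_Icc ha hm) hδ
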